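/- Let (X, f) be a connectivity system with f(∅) = 0 and f({e}) ≤ k for every e ∈ X. A single ultrafilter of order k+1 on (X, f) exists if and only if a linear tangle of order k+1 on (X, f) exists. -/

import Mathlib

open Finset

def SymmSubmodular {α : Type*} [Fintype α] [DecidableEq α] (f : Finset α → ℕ) : Prop :=
  (∀ A : Finset α, f A = f Aᶜ) ∧
  ∀ A B : Finset α, f (A ∩ B) + f (A ∪ B) ≤ f A + f B

def LinearTangle {α : Type*} [Fintype α] [DecidableEq α]
    (f : Finset α → ℕ) (k : ℕ) (L : Set (Finset α)) : Prop :=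
  (∀ A ∈ L, f A ≤ k) ∧
  (∅ : Finset α) ∈ L ∧
  (∀ A : Finset α, f A ≤ k → (A ∈ L ↔ Aᶜ ∉ L)) ∧
  ∀ A ∈ L, ∀ B ∈ L, ∀ e : α, f {e} ≤ k → A ∪ B ∪ {e} ≠ Finset.univ

def SingleFilter {α : Type*} [Fintype α] [DecidableEq α]
    (f : Finset α → ℕ) (k : ℕ) (S : Set (Finset α)) : Prop :=
  (∀ A ∈ S, ∀ e : α, f {e} ≤ k → f (A \ {e}) ≤ k → A \ {e} ∈ S) ∧
  (∀ A ∈ S, ∀ B : Finset α, A ⊆ B → f B ≤ k → B ∈ S) ∧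
  (∅ : Finset α) ∉ S

def SingleUltrafilter {α : Type*} [Fintype α] [DecidableEq α]
    (f : Finset α → ℕ) (k : ℕ) (S : Set (Finset α)) : Prop :=
  SingleFilter f k S ∧ ∀ A : Finset α, f A ≤ k → A ∈ S ∨ Aᶜ ∈ S

/-- One step of a linear decomposition: grow by at most one element, staying efficient. -/
def LStep {α : Type*} [Fintype α] [DecidableEq α] (f : Finset α → ℕ) (k : ℕ)
    (X Y : Finset α) : Prop :=
  f X ≤ k ∧ f Y ≤ k ∧ X ⊆ Y ∧ ∃ e, Y ⊆ insert e X

def LGood {α : Type*} [Fintype α] [DecidableEq α] (f : Finset α → ℕ) (k : ℕ)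
    (I : Set (Finset α)) : Prop :=
  (∀ A ∈ I, f A ≤ k) ∧ (∀ A ∈ I, ∀ B, B ⊆ A → f B ≤ k → B ∈ I) ∧ (∅ : Finset α) ∈ I ∧
  ∀ P ∈ I, ∀ Q, Qᶜ ∈ I → ¬ Relation.ReflTransGen (LStep f k) P Q

section
variable {α : Type*} [Fintype α] [DecidableEq α] {f : Finset α → ℕ} {k : ℕ}

lemma chain_compl (hf : SymmSubmodular f) {P Q : Finset α}
    (h : Relation.ReflTransGen (LStep f k) P Q) :
    Relation.ReflTransGen (LStep f k) Qᶜ Pᶜ := by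
  induction h with
  | refl => exact .refl
  | tail _ hs ih =>
    obtain ⟨h1, h2, h3, e, h4⟩ := hs
    refine Relation.ReflTransGen.head ⟨?_, ?_, ?_, e, ?_⟩ ih
    · rwa [← hf.1]
    · rwa [← hf.1]
    · exact compl_subset_compl.2 h3
    · intro x hx
      have := @h4 x
      simp only [mem_insert, mem_compl] at *
      tauto

lemma chain_sub {P Q : Finset α} (h : Relation.ReflTransGen (LStep f k) P Q) : P ⊆ Q := by
  induction h with
  | refl => exact Subset.rfl
  | tail _ hs ih => exact ih.trans hs.2.2.1

lemma chain_union (hf : SymmSubmodular f) {P Q D : Finset α} (hPk : f P ≤ k) (hPD : P ⊆ D)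
    (hD : ∀ C, P ⊆ C → C ⊆ D → f D ≤ f C)
    (h : Relation.ReflTransGen (LStep f k) P Q) :
    Relation.ReflTransGen (LStep f k) D (D ∪ Q) := by
  have key : ∀ C, P ⊆ C → f C ≤ k → f (D ∪ C) ≤ k := by
    intro C hC hk
    have h1 := hf.2 D C
    have h2 := hD (D ∩ C) (subset_inter hPD hC) inter_subset_left
    omega
  induction h with
  | refl => rw [union_eq_left.2 hPD]
  | tail hc hs ih =>
    obtain ⟨h1, h2, h3, e, h4⟩ := hs
    have hs := chain_sub hc
    refine ih.tail ⟨key _ hs h1, key _ (hs.trans h3) h2, union_subset_union_right h3, e, ?_⟩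
    intro x hx
    have := @h4 x
    simp only [mem_insert, mem_union] at *
    tauto

/-- If `I` is maximal good and `A` is a minimal set outside, `A` can be filled from the right. -/
lemma fill (hf : SymmSubmodular f) {I : Set (Finset α)} (hI : Maximal (LGood f k) I)
    {A : Finset α} (hA : f A ≤ k) (hAI : A ∉ I)
    (hmin : ∀ B, B ⊂ A → f B ≤ k → B ∈ I) :
    ∃ Q, (Qᶜ ∈ I ∨ Qᶜ = A) ∧ Relation.ReflTransGen (LStep f k) A Q := by
  by_contra hcon
  push Not at hcon
  obtain ⟨⟨g1, g2, g3, g4⟩, hmax⟩ := hI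
  have : LGood f k (insert A I) := by
    refine ⟨?_, ?_, Or.inr g3, ?_⟩
    · rintro B (rfl | hB)
      · exact hA
      · exact g1 B hB
    · rintro B (rfl | hB) C hC hk
      · rcases eq_or_ssubset_of_subset hC with rfl | h
        · exact Or.inl rfl
        · exact Or.inr (hmin C h hk)
      · exact Or.inr (g2 B hB C hC hk)
    · rintro P (rfl | hP) Q hQ hc
      · exact hcon Q (hQ.symm) hc
      · rcases hQ with rfl | hQ
        · exact hcon Pᶜ (Or.inl (by simpa using hP)) (chain_compl hf hc)
        · exact g4 P hP Q hQ hc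
  exact hAI (hmax this (Set.subset_insert _ _) (Set.mem_insert _ _))

lemma exists_min {I : Set (Finset α)} (hI : LGood f k I) {A : Finset α} (hA : f A ≤ k)
    (hAI : A ∉ I) : ∃ B, B ⊆ A ∧ f B ≤ k ∧ B ∉ I ∧ ∀ C, C ⊂ B → f C ≤ k → C ∈ I := by
  obtain ⟨B, hBA, hB⟩ := Finite.exists_le_minimal (p := fun B : Finset α => f B ≤ k ∧ B ∉ I)
    (a := A) ⟨hA, hAI⟩
  refine ⟨B, hBA, hB.1.1, hB.1.2, fun C hC hk => ?_⟩
  by_contra h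
  exact hC.2 (hB.2 ⟨hk, h⟩ hC.1)

lemma fill' (hf : SymmSubmodular f) (h0 : f (∅ : Finset α) = 0) {I : Set (Finset α)}
    (hI : Maximal (LGood f k) I)
    {A D : Finset α} (hA : f A ≤ k) (hAI : A ∉ I)
    (hmin : ∀ B, B ⊂ A → f B ≤ k → B ∈ I) (hAD : A ⊆ D)
    (hD : ∀ C, A ⊆ C → C ⊆ D → f D ≤ f C) :
    ∃ Q, Qᶜ ∈ I ∧ Relation.ReflTransGen (LStep f k) D Q := by
  obtain ⟨Q, hQ, hc⟩ := fill hf hI hA hAI hmin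
  have hc' := chain_union hf hA hAD hD hc
  refine ⟨_, ?_, hc'⟩
  have hDQ : f (D ∪ Q)ᶜ ≤ k := by
    rw [← hf.1]
    have hQk : f Q ≤ k := by
      rw [hf.1]
      rcases hQ with h | h
      · exact hI.1.1 _ h
      · rwa [h]
    have h1 := hf.2 D Q
    have h2 := hD (D ∩ Q) (subset_inter hAD (chain_sub hc)) inter_subset_left
    omega
  rcases hQ with h | h
  · exact hI.1.2.1 _ h _ (compl_subset_compl.2 subset_union_right) hDQ
  · have : (D ∪ Q)ᶜ = ∅ := by
      rw [compl_union, h, ← disjoint_iff_inter_eq_empty]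
      exact (disjoint_compl_left).mono_right hAD
    rw [this]
    exact hI.1.2.2.1

lemma complete (hf : SymmSubmodular f) (h0 : f (∅ : Finset α) = 0) {I : Set (Finset α)}
    (hI : Maximal (LGood f k) I) {A : Finset α} (hA : f A ≤ k) : A ∈ I ∨ Aᶜ ∈ I := by
  by_contra hcon
  push Not at hcon
  obtain ⟨A1, a1, a2, a3, a4⟩ := exists_min hI.1 hA hcon.1
  obtain ⟨A2, b1, b2, b3, b4⟩ := exists_min hI.1 (A := Aᶜ) (by rwa [← hf.1]) hcon.2
  have h12 : A1 ⊆ A2ᶜ := a1.trans (by simpa using compl_subset_compl.2 b1)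
  obtain ⟨D, hD, hDm⟩ := Finset.exists_min_image (Finset.Icc A1 A2ᶜ) f
    ⟨A1, Finset.mem_Icc.2 ⟨le_rfl, h12⟩⟩
  rw [Finset.mem_Icc] at hD
  obtain ⟨Q, hQ, hc⟩ := fill' hf h0 hI a2 a3 a4 hD.1
    (fun C h1 h2 => hDm C (Finset.mem_Icc.2 ⟨h1, h2.trans hD.2⟩))
  obtain ⟨P, hP, hc'⟩ := fill' hf h0 hI b2 b3 b4 (D := Dᶜ)
    (by simpa using compl_subset_compl.2 hD.2)
    (fun C h1 h2 => by
      rw [← hf.1, hf.1 C]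
      refine hDm Cᶜ (Finset.mem_Icc.2 ⟨hD.1.trans ?_, compl_subset_compl.2 h1⟩)
      simpa using compl_subset_compl.2 h2)
  have hc2 := chain_compl hf hc'
  rw [compl_compl] at hc2
  exact hI.1.2.2.2 _ hP _ hQ (hc2.trans hc)

end

theorem stmt14 {α : Type*} [Fintype α] [DecidableEq α] (f : Finset α → ℕ) (k : ℕ)
    (hf : SymmSubmodular f) (h0 : f (∅ : Finset α) = 0) (hsing : ∀ e : α, f {e} ≤ k) :
    (∃ S : Set (Finset α), SingleUltrafilter f k S) ↔
      ∃ L : Set (Finset α), LinearTangle f k L := by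
  constructor
  · rintro ⟨S, ⟨s1, s2, s3⟩, s4⟩
    have hdown : ∀ P Q, Relation.ReflTransGen (LStep f k) P Q → Q ∈ S → P ∈ S := by
      intro P Q h
      induction h with
      | refl => exact id
      | tail _ hs ih =>
        rename_i X Y _
        obtain ⟨h1, h2, h3, e, h4⟩ := hs
        intro hY
        apply ih
        by_cases he : e ∈ X
        · rw [insert_eq_of_mem he] at h4
          rwa [h3.antisymm h4]
        · have : X = Y \ {e} ∨ X = Y := by
            by_cases heY : e ∈ Y
            · left
              ext x
              have := @h3 x
              have := @h4 x
              simp only [mem_insert, mem_sdiff, mem_singleton] at *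
              by_cases hx : x = e
              · subst hx; tauto
              · tauto
            · right
              refine h3.antisymm fun x hx => ?_
              rcases mem_insert.1 (h4 hx) with rfl | h
              · exact absurd hx heY
              · exact h
          rcases this with h | h
          · rw [h] at h1 ⊢
            exact s1 Y hY e (hsing e) h1
          · rwa [h]
    have huniv : (univ : Finset α) ∈ S := by
      rcases s4 ∅ (by omega) with h | h
      · exact absurd h s3
      · simpa using h
    have hg : LGood f k {∅} := by
      refine ⟨?_, ?_, rfl, ?_⟩
      · rintro A rfl
        omega
      · rintro A rfl B hB _
        exact subset_empty.1 hB
      · rintro P rfl Q hQ hc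
        have hQ' : Q = univ := compl_eq_empty_iff Q |>.1 hQ
        subst hQ'
        exact s3 (hdown _ _ hc huniv)
    obtain ⟨I, -, hI⟩ := Finite.exists_le_maximal (p := LGood f k) hg
    have hcomp := fun A hA => complete hf h0 hI (A := A) hA
    obtain ⟨g1, g2, g3, g4⟩ := hI.1
    have hnb : ∀ A, A ∈ I → Aᶜ ∉ I := fun A h h' => g4 A h A h' .refl
    have hdis : ∀ A ∈ I, ∀ B ∈ I, ∀ e : α, f (A \ B) ≤ k → A ∪ B ∪ {e} ≠ univ := by
      intro A hA B hB e hk hU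
      refine g4 (A \ B) (g2 A hA _ sdiff_subset hk) Bᶜ (by simpa using hB) (.single
        ⟨hk, ?_, ?_, e, ?_⟩)
      · rw [← hf.1]; exact g1 B hB
      · intro x
        simp
      · intro x
        have : x ∈ A ∪ B ∪ {e} := hU ▸ mem_univ x
        simp only [mem_insert, mem_union, mem_compl, mem_sdiff, mem_singleton] at *
        tauto
    refine ⟨I, g1, g3, fun A hA => ⟨hnb A, fun h => (hcomp A hA).resolve_right h⟩, ?_⟩
    intro A hA B hB e _
    have hsub := hf.2 A Bᶜ
    have e1 : A ∩ Bᶜ = A \ B := by ext; simp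
    have e2 : f (A ∪ Bᶜ) = f (B \ A) := by
      rw [hf.1]; congr 1; ext; simp; tauto
    rw [e1, e2, ← hf.1 B] at hsub
    have := g1 A hA
    have := g1 B hB
    by_cases hk : f (A \ B) ≤ k
    · exact hdis A hA B hB e hk
    · rw [union_comm A B]
      exact hdis B hB A hA e (by omega)
  · rintro ⟨L, l1, l2, l3, l4⟩
    have hne : Nonempty α := by
      by_contra h
      rw [not_nonempty_iff] at h
      have := (l3 ∅ (by omega)).1 l2
      rw [Subsingleton.elim (∅ : Finset α)ᶜ ∅] at this
      exact this l2
    obtain ⟨e0⟩ := hne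
    have hno : ∀ A, f A ≤ k → Aᶜ ∉ L → A ∈ L := fun A h => (l3 A h).2
    refine ⟨{A | Aᶜ ∈ L}, ⟨?_, ?_, ?_⟩, ?_⟩
    · intro A hA e he hk
      by_contra h
      refine l4 _ hA _ (hno _ hk h) e he ?_
      ext x
      simp
      tauto
    · intro A hA B hAB hk
      by_contra h
      refine l4 _ hA _ (hno _ hk h) e0 (hsing e0) ?_
      ext x
      have := @hAB x
      simp
      tauto
    · exact (l3 ∅ (by omega)).1 l2
    · intro A hA
      by_cases h : Aᶜ ∈ L
      · exact Or.inl h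
      · right
        simpa using hno A hA h
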